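/- Let (A,b,c) be an s-stage Runge–Kutta method with Σ_j a_{ij} = c_i for every i, and let p ≥ 1. Then bΦ(t) = 1/t! holds for every rooted tree t with |t| ≤ p if and only if both: (i) Σ_j b_j c_j^n = 1/(n+1) for every 0 ≤ n < p, and (ii) Σ_j D_j(t) Φ_j(t′) = 0 for all rooted trees t and t′ with |t| + |t′| ≤ p. -/

import Mathlib

/-- Rooted trees: `node ts` is the tree obtained by connecting the roots of the
trees in `ts` by new edges to a new root vertex; `node []` is the one-vertex tree `•`. -/
inductive RTree where
  | node : List RTree → RTree

namespace RTree

/-- The order `|t|` of a rooted tree: its number of vertices. -/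
def order : RTree → ℕ
  | node ts => 1 + (ts.attach.map fun x => order x.1).sum
decreasing_by
  simp only [RTree.node.sizeOf_spec]; have := List.sizeOf_lt_of_mem x.2; omega

/-- The tree factorial: `•! = 1` and `[t₁…tₙ]! = |[t₁…tₙ]| ⬝ ∏ₘ tₘ!`. -/
def factorial : RTree → ℕ
  | node ts => (node ts).order * (ts.attach.map fun x => factorial x.1).prod
decreasing_by
  simp only [RTree.node.sizeOf_spec]; have := List.sizeOf_lt_of_mem x.2; omega

end RTree

/-- Derivative weights: `Φ(•) = 𝟙` and `Φ([t₁…tₙ]) = ∏ₘ (A·Φ(tₘ))`, element-wise. -/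
def Phi {s : ℕ} (A : Matrix (Fin s) (Fin s) ℝ) : RTree → Fin s → ℝ
  | .node ts => fun i => (ts.attach.map fun x => A.mulVec (Phi A x.1) i).prod
decreasing_by
  simp only [RTree.node.sizeOf_spec]; have := List.sizeOf_lt_of_mem x.2; omega

/-- `D_j(t) = Σ_i b_i Φ_i(t) a_{ij} − b_j (1 − c_j^{|t|})/t!`. -/
noncomputable def Dvec {s : ℕ} (A : Matrix (Fin s) (Fin s) ℝ) (b c : Fin s → ℝ) (t : RTree)
    (j : Fin s) : ℝ :=
  (∑ i, b i * Phi A t i * A i j) - b j * (1 - c j ^ t.order) / (t.factorial : ℝ)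

namespace RTree

lemma order_node (ts : List RTree) : (node ts).order = 1 + (ts.map order).sum := by
  rw [order, List.attach_map_val]

lemma factorial_node (ts : List RTree) :
    (node ts).factorial = (node ts).order * (ts.map factorial).prod := by
  rw [factorial, List.attach_map_val]

lemma order_pos (t : RTree) : 0 < t.order := by
  cases t; rw [order_node]; omega

lemma factorial_pos : ∀ t : RTree, 0 < t.factorial
  | node ts => by
    rw [factorial_node]
    refine Nat.mul_pos (order_pos _) (List.prod_pos fun n hn => ?_)
    obtain ⟨t, ht, rfl⟩ := List.mem_map.1 hn
    exact factorial_pos t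
decreasing_by
  simp only [RTree.node.sizeOf_spec]; have := List.sizeOf_lt_of_mem ht; omega

/-- Attaching a branch `t` to the root of `node ts`. -/
lemma order_node_cons (t : RTree) (ts : List RTree) :
    (node (t :: ts)).order = (node ts).order + t.order := by
  simp only [order_node, List.map_cons, List.sum_cons]; omega

lemma order_node_append_leaves (ts : List RTree) (n : ℕ) :
    (node (ts ++ List.replicate n (node []))).order = (node ts).order + n := by
  simp [order_node, add_assoc]

lemma order_mul_factorial_node_cons (t : RTree) (ts : List RTree) :
    (node ts).order * (node (t :: ts)).factorial =
      ((node ts).order + t.order) * ((node ts).factorial * t.factorial) := by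
  rw [factorial_node (t :: ts), factorial_node ts, order_node_cons, List.map_cons, List.prod_cons]
  ring

lemma order_mul_factorial_node_append_leaves (ts : List RTree) (n : ℕ) :
    (node ts).order * (node (ts ++ List.replicate n (node []))).factorial =
      ((node ts).order + n) * (node ts).factorial := by
  have h : (node []).factorial = 1 := by simp [factorial_node, order_node]
  rw [factorial_node (ts ++ _), factorial_node ts, order_node_append_leaves]
  simp only [List.map_append, List.map_replicate, h, List.prod_append, List.prod_replicate,
    one_pow]
  ring

/-- The identity between tree factorials matching the D-type order conditions. -/
lemma one_div_factorial_relation (ts us : List RTree) :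
    1 / ((node (node us :: ts)).factorial : ℝ)
      - 1 / ((node us).factorial : ℝ) / ((node ts).factorial : ℝ)
      + 1 / ((node (us ++ List.replicate (node ts).order (node []))).factorial : ℝ)
        / ((node ts).factorial : ℝ) = 0 := by
  have h₁ := order_mul_factorial_node_cons (node us) ts
  have h₂ := order_mul_factorial_node_append_leaves us (node ts).order
  have p₁ := factorial_pos (node (node us :: ts))
  have p₂ := factorial_pos (node (us ++ List.replicate (node ts).order (node [])))
  have p₃ := factorial_pos (node us)
  have p₄ := factorial_pos (node ts)
  have p₅ := order_pos (node us)
  have p₆ := order_pos (node ts)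
  generalize (node (node us :: ts)).factorial = x at *
  generalize (node (us ++ List.replicate (node ts).order (node []))).factorial = y at *
  generalize (node us).factorial = f at *
  generalize (node ts).factorial = g at *
  generalize (node us).order = m at *
  generalize (node ts).order = n at *
  rify at *
  have e₁ : 1 / x = n / ((n + m) * (g * f) : ℝ) := by
    rw [div_eq_div_iff (by positivity) (by positivity)]; linarith
  have e₂ : 1 / y = m / ((m + n) * f : ℝ) := by
    rw [div_eq_div_iff (by positivity) (by positivity)]; linarith
  rw [e₁, e₂]
  field_simp
  ring

end RTree

open RTree

section

variable {s : ℕ} (A : Matrix (Fin s) (Fin s) ℝ)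

lemma Phi_node (ts : List RTree) (i : Fin s) :
    Phi A (node ts) i = (ts.map fun t => A.mulVec (Phi A t) i).prod := by
  simp only [Phi]
  rw [List.attach_map_val (f := fun t => A.mulVec (Phi A t) i)]

lemma Phi_node_cons (t : RTree) (ts : List RTree) (i : Fin s) :
    Phi A (node (t :: ts)) i = A.mulVec (Phi A t) i * Phi A (node ts) i := by
  simp [Phi_node]

variable {A} {c : Fin s → ℝ}

lemma Phi_node_append_leaves (hA : ∀ i, ∑ j, A i j = c i) (ts : List RTree) (n : ℕ)
    (i : Fin s) :
    Phi A (node (ts ++ List.replicate n (node []))) i = Phi A (node ts) i * c i ^ n := by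
  have h : A.mulVec (Phi A (node [])) i = c i := by
    simp [Matrix.mulVec, dotProduct, Phi_node, hA]
  simp only [Phi_node A (ts ++ _), Phi_node A ts, List.map_append, List.map_replicate, h,
    List.prod_append, List.prod_replicate]

lemma sum_Dvec_mul_Phi (hA : ∀ i, ∑ j, A i j = c i) (b : Fin s → ℝ) (ts us : List RTree) :
    ∑ j, Dvec A b c (node ts) j * Phi A (node us) j =
      ∑ i, b i * Phi A (node (node us :: ts)) i
      - (∑ i, b i * Phi A (node us) i) / ((node ts).factorial : ℝ)
      + (∑ i, b i * Phi A (node (us ++ List.replicate (node ts).order (node []))) i)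
        / ((node ts).factorial : ℝ) := by
  have h : ∑ i, b i * Phi A (node (node us :: ts)) i =
      ∑ j, (∑ i, b i * Phi A (node ts) i * A i j) * Phi A (node us) j := by
    simp only [Phi_node_cons, Matrix.mulVec, dotProduct, Finset.sum_mul, Finset.mul_sum]
    rw [Finset.sum_comm]
    exact Finset.sum_congr rfl fun j _ => Finset.sum_congr rfl fun i _ => by ring
  rw [h, Finset.sum_div, Finset.sum_div, ← Finset.sum_sub_distrib, ← Finset.sum_add_distrib]
  refine Finset.sum_congr rfl fun j _ => ?_
  rw [Phi_node_append_leaves hA, Dvec]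
  ring

/-- The quadrature conditions are the order conditions of the trees whose branches are leaves. -/
lemma order_condition_leaves_iff (hA : ∀ i, ∑ j, A i j = c i) (b : Fin s → ℝ) (n : ℕ) :
    ∑ i, b i * Phi A (node (List.replicate n (node []))) i =
        1 / ((node (List.replicate n (node []))).factorial : ℝ) ↔
      ∑ j, b j * c j ^ n = 1 / ((n : ℝ) + 1) := by
  have hΦ : ∀ i, Phi A (node (List.replicate n (node []))) i = c i ^ n := fun i => by
    simpa [Phi_node A []] using Phi_node_append_leaves hA [] n i
  have hf : (node (List.replicate n (node []))).factorial = n + 1 := by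
    simpa [factorial_node [], order_node [], add_comm] using
      order_mul_factorial_node_append_leaves [] n
  simp only [hΦ, hf, Nat.cast_add, Nat.cast_one]

/-- Moving the branches of a child to the root and turning the rest into leaves reduces every
order condition to a quadrature condition. -/
lemma order_condition_of_Dvec {b : Fin s → ℝ} (hA : ∀ i, ∑ j, A i j = c i) {p : ℕ}
    (hquad : ∀ n < p, ∑ j, b j * c j ^ n = 1 / ((n : ℝ) + 1))
    (hD : ∀ t t' : RTree, t.order + t'.order ≤ p → ∑ j, Dvec A b c t j * Phi A t' j = 0)
    (ts : List RTree) (m : ℕ) (h : (node (ts ++ List.replicate m (node []))).order ≤ p) :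
    ∑ i, b i * Phi A (node (ts ++ List.replicate m (node []))) i =
      1 / ((node (ts ++ List.replicate m (node []))).factorial : ℝ) := by
  match ts, h with
  | [], h =>
    rw [order_node_append_leaves] at h
    have := order_pos (node [])
    exact (order_condition_leaves_iff hA b m).2 (hquad m (by omega))
  | node us :: ts, h =>
    rw [List.cons_append] at h ⊢
    have ho := order_node_cons (node us) (ts ++ List.replicate m (node []))
    have hm := order_node_append_leaves ts m
    have hn := order_node_append_leaves us (node (ts ++ List.replicate m (node []))).order
    have hpos := order_pos (node ts)
    have hpos' := order_pos (node us)
    have hlow := order_condition_of_Dvec hA hquad hD us 0 (by simp; omega)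
    have hmove := order_condition_of_Dvec hA hquad hD us
      (node (ts ++ List.replicate m (node []))).order (by omega)
    have hd := hD (node (ts ++ List.replicate m (node []))) (node us) (by omega)
    rw [List.replicate_zero, List.append_nil] at hlow
    rw [sum_Dvec_mul_Phi hA, hlow, hmove] at hd
    linarith [one_div_factorial_relation (ts ++ List.replicate m (node [])) us]
termination_by
  ((node (ts ++ List.replicate m (node []))).order, p - m)
decreasing_by
  · rw [List.cons_append, List.replicate_zero, List.append_nil]
    exact Prod.Lex.left _ _ (by omega)
  · rw [List.cons_append] at h ⊢
    rw [show (node (us ++ _)).order = _ from hn.trans ((add_comm _ _).trans ho.symm)]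
    exact Prod.Lex.right _ (by omega)

end

/-- Order conditions up to order `p` hold iff the quadrature conditions and the
D-type order conditions hold. -/
theorem order_conditions_iff_D_type {s : ℕ} (A : Matrix (Fin s) (Fin s) ℝ)
    (b c : Fin s → ℝ) (hA : ∀ i, ∑ j, A i j = c i) (p : ℕ) (hp : 1 ≤ p) :
    (∀ t : RTree, t.order ≤ p → ∑ i, b i * Phi A t i = 1 / (t.factorial : ℝ)) ↔
      ((∀ n < p, ∑ j, b j * c j ^ n = 1 / ((n : ℝ) + 1)) ∧
        (∀ t t' : RTree, t.order + t'.order ≤ p →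
          (∑ j, Dvec A b c t j * Phi A t' j) = 0)) := by
  constructor
  · intro H
    refine ⟨fun n hn => (order_condition_leaves_iff hA b n).1 (H _ ?_), ?_⟩
    · simp [order_node]; omega
    · rintro ⟨ts⟩ ⟨us⟩ h
      have hpos := order_pos (node ts)
      rw [sum_Dvec_mul_Phi hA, H _ (by rw [order_node_cons]; omega), H (node us) (by omega),
        H _ (by rw [order_node_append_leaves]; omega)]
      exact one_div_factorial_relation ts us
  · rintro ⟨hquad, hD⟩ ⟨ts⟩ h
    simpa using order_condition_of_Dvec hA hquad hD ts 0 (by simpa using h)
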